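/- arXiv:1802.04904 — 3 statements merged into one kernel-verified Lean document; each statement's English description precedes it below -/
import Mathlib

section
/- Let A = (A_k)_{k=1}^d and B = (B_k)_{k=1}^d be irreducible tensors of D×D complex matrices. Then there exists a nonzero D×D complex matrix X with ∑_k A_k X B_k† = X if and only if there exists a unitary D×D matrix U with A_k = U B_k U† for all k. -/
open Matrix
open scoped ComplexOrder

/-- A tensor `A = (A_k)` of `D×D` complex matrices is irreducible if
`∑ A_kᴴ A_k = 1` and the super-operator `X ↦ ∑ A_k X A_kᴴ` has exactly one
stationary state, and this state is positive definite. -/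
def IsIrreducibleTensor {d D : ℕ} (A : Fin d → Matrix (Fin D) (Fin D) ℂ) : Prop :=
  (∑ k, (A k)ᴴ * A k) = 1 ∧
  ∃ ρ : Matrix (Fin D) (Fin D) ℂ,
    ρ.PosDef ∧ ρ.trace = 1 ∧ (∑ k, A k * ρ * (A k)ᴴ) = ρ ∧
    ∀ σ : Matrix (Fin D) (Fin D) ℂ,
      σ.PosSemidef → σ.trace = 1 → (∑ k, A k * σ * (A k)ᴴ) = σ → σ = ρ

namespace Matrix.PosDef

variable {n m : Type*} [Fintype n] [DecidableEq n]

/-- Conjugating a positive definite matrix by `Z` gives zero only if `Z = 0`. -/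
theorem eq_zero_of_mul_mul_conjTranspose_eq_zero {ρ : Matrix n n ℂ} (hρ : ρ.PosDef)
    {Z : Matrix m n ℂ} (h : Z * ρ * Zᴴ = 0) : Z = 0 := by
  obtain ⟨C, hC⟩ : ∃ C : Matrix n n ℂ, ρ = Cᴴ * C := by
    open scoped MatrixOrder in
    exact CStarAlgebra.nonneg_iff_eq_star_mul_self.mp hρ.posSemidef.nonneg
  have hCZ : C * Zᴴ = 0 := by
    rw [← conjTranspose_mul_self_eq_zero, ← h, hC]
    simp [Matrix.mul_assoc]
  have hρZ : ρ * Zᴴ = 0 := by rw [hC, Matrix.mul_assoc, hCZ, Matrix.mul_zero]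
  have hdet : IsUnit ρ.det := (isUnit_iff_isUnit_det ρ).mp hρ.isUnit
  have hZ : Zᴴ = 0 := by
    rw [← nonsing_inv_mul_cancel_left ρ Zᴴ hdet, hρZ, Matrix.mul_zero]
  simpa using hZ

/-- If the nonnegative numbers `tr (Z_k ρ Z_kᴴ)` sum to zero, every `Z_k` vanishes. -/
theorem eq_zero_of_sum_trace_eq_zero {ι : Type*} [Fintype ι] [Fintype m] {ρ : Matrix n n ℂ}
    (hρ : ρ.PosDef) {Z : ι → Matrix m n ℂ} (h : ∑ k, (Z k * ρ * (Z k)ᴴ).trace = 0) (k : ι) : Z k = 0 := by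
  have hpsd : ∀ k, (Z k * ρ * (Z k)ᴴ).PosSemidef := fun k =>
    hρ.posSemidef.mul_mul_conjTranspose_same (Z k)
  have htr := (Finset.sum_eq_zero_iff_of_nonneg fun k _ => (hpsd k).trace_nonneg).mp h k
    (Finset.mem_univ k)
  exact hρ.eq_zero_of_mul_mul_conjTranspose_eq_zero ((hpsd k).trace_eq_zero_iff.mp htr)

end Matrix.PosDef

section Intertwiners

variable {d D : ℕ} {A B : Fin d → Matrix (Fin D) (Fin D) ℂ}

/-- A fixed point `Y ρ` of `X ↦ ∑ A_k X B_kᴴ`, with `ρ` a faithful stationary state of `B`,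
gives an intertwiner `Y` from `B` to `A`. -/
theorem intertwines_of_fixedPoint {ρ Y : Matrix (Fin D) (Fin D) ℂ}
    (hA : ∑ k, (A k)ᴴ * A k = 1) (hρ : ρ.PosDef) (hBρ : ∑ k, B k * ρ * (B k)ᴴ = ρ)
    (hY : ∑ k, A k * (Y * ρ) * (B k)ᴴ = Y * ρ) (k : Fin d) : A k * Y = Y * B k := by
  have hY' : ∑ k, B k * (ρ * Yᴴ) * (A k)ᴴ = ρ * Yᴴ := by
    have := congrArg conjTranspose hY
    simpa [conjTranspose_sum, Matrix.mul_assoc, hρ.isHermitian.eq] using this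
  refine sub_eq_zero.mp (hρ.eq_zero_of_sum_trace_eq_zero (Z := fun k => A k * Y - Y * B k) ?_ k)
  have expand : ∀ k, ((A k * Y - Y * B k) * ρ * (A k * Y - Y * B k)ᴴ).trace =
      ((A k)ᴴ * A k * (Y * ρ * Yᴴ)).trace - (A k * (Y * ρ) * (B k)ᴴ * Yᴴ).trace
        - (Y * (B k * (ρ * Yᴴ) * (A k)ᴴ)).trace + (Y * (B k * ρ * (B k)ᴴ) * Yᴴ).trace := by
    intro k
    rw [Matrix.mul_assoc (A k)ᴴ, trace_mul_comm (A k)ᴴ]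
    simp only [conjTranspose_sub, conjTranspose_mul, Matrix.sub_mul, Matrix.mul_sub, trace_sub,
      Matrix.mul_assoc]
    ring
  simp only [expand, Finset.sum_add_distrib, Finset.sum_sub_distrib, ← trace_sum,
    ← Finset.sum_mul, ← Finset.mul_sum, hA, hBρ, hY, hY']
  simp [Matrix.mul_assoc]

/-- A Hermitian fixed point of the dual map `M ↦ ∑ B_kᴴ M B_k` commutes with every `B_k`,
provided `B` has a faithful stationary state. -/
theorem commute_of_dual_fixedPoint {ρ M : Matrix (Fin D) (Fin D) ℂ}
    (hB : ∑ k, (B k)ᴴ * B k = 1) (hρ : ρ.PosDef) (hBρ : ∑ k, B k * ρ * (B k)ᴴ = ρ)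
    (hM : M.IsHermitian) (hBM : ∑ k, (B k)ᴴ * M * B k = M) (k : Fin d) :
    B k * M = M * B k := by
  refine sub_eq_zero.mp (hρ.eq_zero_of_sum_trace_eq_zero (Z := fun k => B k * M - M * B k) ?_ k)
  have expand : ∀ k, ((B k * M - M * B k) * ρ * (B k * M - M * B k)ᴴ).trace =
      ((B k)ᴴ * B k * (M * ρ * M)).trace - ((B k)ᴴ * M * B k * (M * ρ)).trace
        - ((B k)ᴴ * M * B k * (ρ * M)).trace + (M * (B k * ρ * (B k)ᴴ) * M).trace := by
    intro k
    have cyc₁ : ((B k)ᴴ * B k * (M * ρ * M)).trace = (B k * (M * ρ * M) * (B k)ᴴ).trace := by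
      rw [Matrix.mul_assoc, trace_mul_comm]
    have cyc₂ : ((B k)ᴴ * M * B k * (M * ρ)).trace = (B k * (M * ρ) * ((B k)ᴴ * M)).trace := by
      rw [Matrix.mul_assoc _ (B k), trace_mul_comm]
    have cyc₃ : ((B k)ᴴ * M * B k * (ρ * M)).trace = (M * B k * (ρ * M) * (B k)ᴴ).trace := by
      rw [Matrix.mul_assoc (B k)ᴴ, Matrix.mul_assoc (B k)ᴴ, trace_mul_comm]
    rw [cyc₁, cyc₂, cyc₃]
    simp only [conjTranspose_sub, conjTranspose_mul, Matrix.sub_mul, Matrix.mul_sub, trace_sub,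
      Matrix.mul_assoc, hM.eq]
    ring
  simp only [expand, Finset.sum_add_distrib, Finset.sum_sub_distrib, ← trace_sum,
    ← Finset.sum_mul, ← Finset.mul_sum, hB, hBρ, hBM]
  simp [Matrix.mul_assoc, trace_mul_comm M (ρ * M), trace_mul_comm M (M * ρ)]

/-- A nonzero intertwiner into an irreducible tensor, from a tensor with a faithful stationary
state, is invertible. -/
theorem IsIrreducibleTensor.isUnit_of_intertwines (hA : IsIrreducibleTensor A)
    {ρ Y : Matrix (Fin D) (Fin D) ℂ} (hρ : ρ.PosDef) (hBρ : ∑ k, B k * ρ * (B k)ᴴ = ρ)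
    (hY : ∀ k, A k * Y = Y * B k) (hY0 : Y ≠ 0) : IsUnit Y := by
  obtain ⟨-, τ, hτ, -, -, huniq⟩ := hA
  have hpsd : (Y * ρ * Yᴴ).PosSemidef := hρ.posSemidef.mul_mul_conjTranspose_same Y
  have hfix : ∑ k, A k * (Y * ρ * Yᴴ) * (A k)ᴴ = Y * ρ * Yᴴ := by
    have step : ∀ k, A k * (Y * ρ * Yᴴ) * (A k)ᴴ = Y * (B k * ρ * (B k)ᴴ) * Yᴴ := by
      intro k
      calc A k * (Y * ρ * Yᴴ) * (A k)ᴴ = (A k * Y) * ρ * (A k * Y)ᴴ := by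
            simp [Matrix.mul_assoc]
        _ = Y * (B k * ρ * (B k)ᴴ) * Yᴴ := by
            rw [hY k]
            simp [Matrix.mul_assoc]
    simp only [step, ← Finset.sum_mul, ← Finset.mul_sum, hBρ]
  have htr : (Y * ρ * Yᴴ).trace ≠ 0 := fun h =>
    hY0 (hρ.eq_zero_of_mul_mul_conjTranspose_eq_zero (hpsd.trace_eq_zero_iff.mp h))
  set c := (Y * ρ * Yᴴ).trace with hc
  have hstate : c⁻¹ • (Y * ρ * Yᴴ) = τ := by
    refine huniq _ (hpsd.smul (inv_nonneg.mpr hpsd.trace_nonneg)) ?_ ?_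
    · rw [trace_smul, ← hc, smul_eq_mul, inv_mul_cancel₀ htr]
    · simp only [Matrix.mul_smul, Matrix.smul_mul, ← Finset.smul_sum, hfix]
  have hright : Y * (c⁻¹ • (ρ * Yᴴ) * τ⁻¹) = 1 := by
    rw [← Matrix.mul_assoc, Matrix.mul_smul, ← Matrix.mul_assoc, hstate]
    exact mul_nonsing_inv τ ((isUnit_iff_isUnit_det τ).mp hτ.isUnit)
  exact IsUnit.of_mul_eq_one _ hright

/-- A matrix commuting with an irreducible tensor is scalar. -/
theorem IsIrreducibleTensor.exists_eq_smul_one [NeZero D] (hB : IsIrreducibleTensor B)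
    {M : Matrix (Fin D) (Fin D) ℂ} (hM : ∀ k, B k * M = M * B k) :
    ∃ c : ℂ, M = c • (1 : Matrix (Fin D) (Fin D) ℂ) := by
  obtain ⟨c, hc⟩ := spectrum.nonempty_of_isAlgClosed_of_finiteDimensional ℂ M
  refine ⟨c, ?_⟩
  by_contra hne
  obtain ⟨ρ, hρ, -, hBρ, -⟩ := hB.2
  refine hc (hB.isUnit_of_intertwines hρ hBρ (fun k => ?_) fun h => hne ?_)
  · rw [Algebra.algebraMap_eq_smul_one]
    simp [Matrix.mul_sub, Matrix.sub_mul, hM k]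
  · rw [← sub_eq_zero.mp h, Algebra.algebraMap_eq_smul_one]

/-- A nonzero intertwiner between irreducible tensors can be rescaled to a unitary one. -/
theorem IsIrreducibleTensor.exists_unitary_of_intertwines (hA : IsIrreducibleTensor A)
    (hB : IsIrreducibleTensor B) {Y : Matrix (Fin D) (Fin D) ℂ} (hY0 : Y ≠ 0)
    (hY : ∀ k, A k * Y = Y * B k) :
    ∃ U ∈ Matrix.unitaryGroup (Fin D) ℂ, ∀ k, A k = U * B k * Uᴴ := by
  obtain ⟨hBone, ρ, hρ, hρtr, hBρ, -⟩ := id hB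
  have : NeZero D := ⟨by rintro rfl; simp at hρtr⟩
  have hdual : ∑ k, (B k)ᴴ * (Yᴴ * Y) * B k = Yᴴ * Y := by
    have step : ∀ k, (B k)ᴴ * (Yᴴ * Y) * B k = Yᴴ * ((A k)ᴴ * A k) * Y := by
      intro k
      calc (B k)ᴴ * (Yᴴ * Y) * B k = (Y * B k)ᴴ * (Y * B k) := by simp [Matrix.mul_assoc]
        _ = Yᴴ * ((A k)ᴴ * A k) * Y := by
            rw [← hY k]
            simp [Matrix.mul_assoc]
    simp only [step, ← Finset.sum_mul, ← Finset.mul_sum, hA.1, Matrix.mul_one]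
  obtain ⟨c, hc⟩ := hB.exists_eq_smul_one
    (commute_of_dual_fixedPoint hBone hρ hBρ (isHermitian_conjTranspose_mul_self Y) hdual)
  have hc0 : 0 ≤ c := by
    have := (posSemidef_conjTranspose_mul_self Y).diag_nonneg (i := (0 : Fin D))
    simpa [hc] using this
  have hcne : c ≠ 0 := by
    rintro rfl
    exact hY0 (conjTranspose_mul_self_eq_zero.mp (by simpa using hc))
  obtain ⟨r, hr, rfl⟩ : ∃ r : ℝ, 0 ≤ r ∧ (r : ℂ) = c :=
    ⟨c.re, (Complex.nonneg_iff.mp hc0).1,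
      (Complex.eq_re_of_ofReal_le (r := 0) (by simpa using hc0)).symm⟩
  have hrne : (Real.sqrt r : ℂ) ≠ 0 := by
    intro h
    exact hcne (by simpa [Real.sqrt_eq_zero hr] using h)
  have hsq : (r : ℂ) = Real.sqrt r * Real.sqrt r := by
    exact_mod_cast (Real.mul_self_sqrt hr).symm
  set s : ℂ := (Real.sqrt r : ℂ) with hs
  have hsstar : star s = s := Complex.conj_ofReal _
  have hU : (s⁻¹ • Y)ᴴ * (s⁻¹ • Y) = 1 := by
    rw [conjTranspose_smul, Matrix.smul_mul, Matrix.mul_smul, hc, star_inv₀, hsstar, hsq,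
      smul_smul, smul_smul]
    field_simp
    simp
  refine ⟨s⁻¹ • Y, mem_unitaryGroup_iff'.mpr hU, fun k => ?_⟩
  rw [Matrix.smul_mul, ← hY k, ← Matrix.mul_smul, Matrix.mul_assoc, mul_eq_one_comm.mp hU,
    Matrix.mul_one]

end Intertwiners

/-- For irreducible tensors `A`, `B`, there is a nonzero fixed point of
`X ↦ ∑ A_k X B_kᴴ` iff `A` and `B` are unitarily equivalent. -/
theorem stationary_coherence_iff_unitarily_equivalent {d D : ℕ}
    (A B : Fin d → Matrix (Fin D) (Fin D) ℂ)
    (hA : IsIrreducibleTensor A) (hB : IsIrreducibleTensor B) :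
    (∃ X : Matrix (Fin D) (Fin D) ℂ, X ≠ 0 ∧ (∑ k, A k * X * (B k)ᴴ) = X) ↔
    (∃ U : Matrix (Fin D) (Fin D) ℂ, U ∈ Matrix.unitaryGroup (Fin D) ℂ ∧
        ∀ k, A k = U * B k * Uᴴ) := by
  obtain ⟨ρ, hρ, hρtr, hBρ, -⟩ := hB.2
  have hdet : IsUnit ρ.det := (isUnit_iff_isUnit_det ρ).mp hρ.isUnit
  constructor
  · rintro ⟨X, hX0, hX⟩
    have hXρ : X * ρ⁻¹ * ρ = X := nonsing_inv_mul_cancel_right ρ X hdet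
    refine hA.exists_unitary_of_intertwines hB (Y := X * ρ⁻¹) (fun h => hX0 ?_)
      (intertwines_of_fixedPoint hA.1 hρ hBρ (by rw [hXρ, hX]))
    rw [← hXρ, h, Matrix.zero_mul]
  · rintro ⟨U, hU, hUB⟩
    have hUU : Uᴴ * U = 1 := mem_unitaryGroup_iff'.mp hU
    refine ⟨U * ρ, fun h => ?_, ?_⟩
    · have hρ0 : ρ = 0 := by
        rw [← Matrix.one_mul ρ, ← hUU, Matrix.mul_assoc, h, Matrix.mul_zero]
      simp [hρ0] at hρtr
    · have step : ∀ k, A k * (U * ρ) * (B k)ᴴ = U * (B k * ρ * (B k)ᴴ) := by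
        intro k
        calc A k * (U * ρ) * (B k)ᴴ = U * B k * (Uᴴ * U) * ρ * (B k)ᴴ := by
              rw [hUB k]
              simp only [Matrix.mul_assoc]
          _ = U * (B k * ρ * (B k)ᴴ) := by
              rw [hUU]
              simp only [Matrix.mul_one, Matrix.mul_assoc]
      simp only [step, ← Finset.mul_sum, hBρ]
end

section
/- Let (E_k)_{k=1}^d be D×D complex matrices with ∑_k E_k† E_k = I. Then there exists a density matrix ρ (a positive semidefinite D×D matrix with trace 1) such that ∑_k E_k ρ E_k† = ρ; that is, every trace-preserving Kraus super-operator has at least one stationary state. -/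
open Matrix
open scoped ComplexOrder

open Filter Topology in
/-- A continuous linear self-map of a nonempty compact convex set has a fixed point. -/
theorem ContinuousLinearMap.exists_mem_apply_eq_self_of_isCompact_of_convex {V : Type*}
    [NormedAddCommGroup V] [NormedSpace ℝ V] (T : V →L[ℝ] V) {S : Set V} (hS : IsCompact S)
    (hconv : Convex ℝ S) (hne : S.Nonempty) (hT : Set.MapsTo T S S) : ∃ x ∈ S, T x = x := by
  obtain ⟨x₀, hx₀⟩ := hne
  let a : ℕ → V := fun n ↦ birkhoffAverage ℝ T id n x₀
  have ha_mem (n : ℕ) : a (n + 1) ∈ S := by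
    have hn : ((n + 1 : ℕ) : ℝ) ≠ 0 := by positivity
    simp only [a, birkhoffAverage, birkhoffSum, Finset.smul_sum]
    refine hconv.sum_mem (fun _ _ ↦ by positivity) ?_ fun k _ ↦ hT.iterate k hx₀
    rw [Finset.sum_const, Finset.card_range, nsmul_eq_mul, mul_inv_cancel₀ hn]
  have ha_sub : Tendsto (fun n ↦ T (a n) - a n) atTop (𝓝 0) := by
    have hbdd : Bornology.IsBounded (Set.range fun n ↦ id (T^[n] x₀)) :=
      hS.isBounded.subset (Set.range_subset_iff.2 fun n ↦ hT.iterate n hx₀)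
    refine (tendsto_birkhoffAverage_apply_sub_birkhoffAverage ℝ hbdd).congr fun n ↦ ?_
    simp only [a, map_birkhoffAverage ℝ ℝ T]
    simp [birkhoffAverage, birkhoffSum, ← Function.iterate_succ_apply,
      Function.iterate_succ_apply']
  obtain ⟨x, hx, φ, hφ, hlim⟩ := hS.tendsto_subseq ha_mem
  refine ⟨x, hx, sub_eq_zero.1 (tendsto_nhds_unique (((T.continuous.tendsto x).comp hlim).sub hlim)
    (ha_sub.comp ((tendsto_add_atTop_nat 1).comp hφ.tendsto_atTop)))⟩

namespace Matrix

variable {n : Type*} [Fintype n]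

/-- The set of density matrices: positive semidefinite complex matrices of trace one. -/
def densityMatrices (n : Type*) [Fintype n] : Set (Matrix n n ℂ) :=
  {ρ | ρ.PosSemidef ∧ ρ.trace = 1}

theorem PosSemidef.re_diag_le_re_trace {A : Matrix n n ℂ} (hA : A.PosSemidef) (i : n) :
    (A i i).re ≤ A.trace.re := by
  rw [trace, Complex.re_sum]
  exact Finset.single_le_sum (f := fun j ↦ (A j j).re)
    (fun j _ ↦ (Complex.le_def.1 hA.diag_nonneg).1) (Finset.mem_univ i)

open scoped MatrixOrder Matrix.Norms.L2Operator in
theorem PosSemidef.norm_apply_le_re_trace {A : Matrix n n ℂ} (hA : A.PosSemidef) (i j : n) :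
    ‖A i j‖ ≤ A.trace.re := by
  classical
  have hdiag : ‖A i j‖ ≤ ((A i i).re + (A j j).re) / 2 := by
    obtain ⟨B, rfl⟩ := CStarAlgebra.nonneg_iff_eq_star_mul_self.1 hA.nonneg
    rw [star_eq_conjTranspose]
    have hre (l : n) : ((Bᴴ * B) l l).re = ∑ k, ‖B k l‖ ^ 2 := by
      simp [mul_apply, Complex.re_sum, Complex.sq_norm, Complex.normSq_apply]
    rw [hre, hre, ← Finset.sum_add_distrib, Finset.sum_div, mul_apply]
    refine norm_sum_le_of_le _ fun k _ ↦ ?_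
    rw [conjTranspose_apply, norm_mul, norm_star]
    nlinarith [sq_nonneg (‖B k i‖ - ‖B k j‖)]
  linarith [hA.re_diag_le_re_trace i, hA.re_diag_le_re_trace j]

theorem isClosed_setOf_posSemidef : IsClosed {A : Matrix n n ℂ | A.PosSemidef} := by
  simp only [posSemidef_iff_dotProduct_mulVec, Set.ofPred_and, Set.ofPred_forall]
  refine (isClosed_eq (by fun_prop) continuous_id).inter (isClosed_iInter fun x ↦ ?_)
  exact isClosed_le continuous_const (by fun_prop)

theorem isCompact_densityMatrices : IsCompact (densityMatrices n) := by
  have hK : IsCompact (Set.univ.pi fun _ : n ↦ Set.univ.pi fun _ : n ↦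
      Metric.closedBall (0 : ℂ) 1) :=
    isCompact_univ_pi fun _ ↦ isCompact_univ_pi fun _ ↦ isCompact_closedBall 0 1
  refine hK.of_isClosed_subset ?_ fun ρ hρ i _ j _ ↦ ?_
  · exact isClosed_setOf_posSemidef.inter (isClosed_eq (by fun_prop) continuous_const)
  · simpa [hρ.2] using hρ.1.norm_apply_le_re_trace i j

theorem convex_densityMatrices : Convex ℝ (densityMatrices n) := by
  rintro ρ ⟨hρ, hρ_trace⟩ σ ⟨hσ, hσ_trace⟩ a b ha hb hab
  refine ⟨(hρ.smul ha).add (hσ.smul hb), ?_⟩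
  rw [trace_add, trace_smul, trace_smul, hρ_trace, hσ_trace, ← add_smul, hab, one_smul]

theorem densityMatrices_nonempty [Nonempty n] : (densityMatrices n).Nonempty := by
  classical
  obtain ⟨i⟩ := ‹Nonempty n›
  refine ⟨diagonal (Pi.single i 1), PosSemidef.diagonal (Pi.single_nonneg.2 zero_le_one), ?_⟩
  simp [trace_diagonal]

/-- The Kraus super-operator `X ↦ ∑ k, E k * X * (E k)ᴴ`. -/
def krausMap {ι : Type*} [Fintype ι] (E : ι → Matrix n n ℂ) : Matrix n n ℂ →ₗ[ℝ] Matrix n n ℂ where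
  toFun X := ∑ k, E k * X * (E k)ᴴ
  map_add' X Y := by simp [mul_add, add_mul, Finset.sum_add_distrib]
  map_smul' c X := by simp [Finset.smul_sum]

theorem mapsTo_krausMap_densityMatrices [DecidableEq n] {ι : Type*} [Fintype ι]
    {E : ι → Matrix n n ℂ} (hE : ∑ k, (E k)ᴴ * E k = 1) :
    Set.MapsTo (krausMap E) (densityMatrices n) (densityMatrices n) := by
  rintro ρ ⟨hρ, hρ_trace⟩
  refine ⟨posSemidef_sum _ fun k _ ↦ hρ.mul_mul_conjTranspose_same (E k), ?_⟩
  change (∑ k, E k * ρ * (E k)ᴴ).trace = 1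
  simp_rw [trace_sum, trace_mul_comm (E _ * ρ), ← Matrix.mul_assoc, ← trace_sum, ← Finset.sum_mul]
  rw [hE, one_mul, hρ_trace]

end Matrix

/-- Every trace-preserving Kraus super-operator has at least one stationary state:
if `∑ E_kᴴ E_k = 1` then there is a density matrix `ρ` with `∑ E_k ρ E_kᴴ = ρ`. -/
theorem exists_stationary_state {d D : ℕ} (hD : 0 < D)
    (E : Fin d → Matrix (Fin D) (Fin D) ℂ)
    (hE : (∑ k, (E k)ᴴ * E k) = 1) :
    ∃ ρ : Matrix (Fin D) (Fin D) ℂ,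
      ρ.PosSemidef ∧ ρ.trace = 1 ∧ (∑ k, E k * ρ * (E k)ᴴ) = ρ := by
  have : Nonempty (Fin D) := Fin.pos_iff_nonempty.1 hD
  let : NormedAddCommGroup (Matrix (Fin D) (Fin D) ℂ) := Matrix.normedAddCommGroup
  let : NormedSpace ℝ (Matrix (Fin D) (Fin D) ℂ) := Matrix.normedSpace
  obtain ⟨ρ, ⟨hρ, hρ_trace⟩, hfix⟩ :=
    (krausMap E).toContinuousLinearMap.exists_mem_apply_eq_self_of_isCompact_of_convex
      isCompact_densityMatrices convex_densityMatrices densityMatrices_nonempty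
      (mapsTo_krausMap_densityMatrices hE)
  exact ⟨ρ, hρ, hρ_trace, hfix⟩
end

section
/- Let (E_k)_{k=1}^d be D×D complex matrices, let P and Q be D×D orthogonal projections with P Q = 0, let θ ∈ ℝ, and let A be a D×D matrix with A = Q A P and ∑_k E_k A E_k† = e^{iθ} A. Define V = e^{−iθ} Q + (I − Q). Then V is unitary and V (∑_k E_k A E_k†) V† = A; that is, A is a fixed point of the modified super-operator X ↦ V (∑_k E_k X E_k†) V†. -/
open Matrix

/-- Converting a continuous coherence into a stationary one: if `A = Q A P` with
`P`, `Q` orthogonal projections, `P Q = 0`, and `∑ E_k A E_kᴴ = e^{iθ} A`, then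
`V = e^{−iθ} Q + (I − Q)` is unitary and `V (∑ E_k A E_kᴴ) Vᴴ = A`. -/
theorem continuous_to_stationary_coherence {d D : ℕ}
    (E : Fin d → Matrix (Fin D) (Fin D) ℂ)
    (P Q : Matrix (Fin D) (Fin D) ℂ)
    (hP : P = Pᴴ) (hP2 : P = P * P) (hQ : Q = Qᴴ) (hQ2 : Q = Q * Q)
    (hPQ : P * Q = 0)
    (θ : ℝ)
    (A : Matrix (Fin D) (Fin D) ℂ) (hA : A = Q * A * P)
    (hfix : (∑ k, E k * A * (E k)ᴴ) = Complex.exp (θ * Complex.I) • A) :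
    (Complex.exp (-θ * Complex.I) • Q + (1 - Q)) ∈ Matrix.unitaryGroup (Fin D) ℂ ∧
    (Complex.exp (-θ * Complex.I) • Q + (1 - Q)) * (∑ k, E k * A * (E k)ᴴ) *
        (Complex.exp (-θ * Complex.I) • Q + (1 - Q))ᴴ = A := by
  have hQA : Q * A = A := by
    rw [hA, ← Matrix.mul_assoc, ← Matrix.mul_assoc, ← hQ2]
  have hAQ : A * Q = 0 := by
    rw [hA, Matrix.mul_assoc, hPQ, Matrix.mul_zero]
  have hexp : Complex.exp (-θ * Complex.I) * Complex.exp (θ * Complex.I) = 1 := by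
    rw [← Complex.exp_add]
    simp
  have hstar : star (Complex.exp (-θ * Complex.I)) = Complex.exp (θ * Complex.I) := by
    rw [Complex.star_def, ← Complex.exp_conj]
    simp
  have hVH : (Complex.exp (-θ * Complex.I) • Q + (1 - Q))ᴴ =
      Complex.exp (θ * Complex.I) • Q + (1 - Q) := by
    rw [conjTranspose_add, conjTranspose_smul, conjTranspose_sub, conjTranspose_one, ← hQ, hstar]
  refine ⟨?_, ?_⟩
  · rw [Matrix.mem_unitaryGroup_iff, star_eq_conjTranspose, hVH]
    simp [Matrix.add_mul, Matrix.mul_add, Matrix.sub_mul, Matrix.mul_sub, ← hQ2, smul_smul,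
      mul_comm (Complex.exp (θ * Complex.I)), ← Complex.exp_add]
  · have hVA : (Complex.exp (-θ * Complex.I) • Q + (1 - Q)) * A =
        Complex.exp (-θ * Complex.I) • A := by
      simp [Matrix.add_mul, Matrix.sub_mul, hQA]
    have hAV : A * (Complex.exp (θ * Complex.I) • Q + (1 - Q)) = A := by
      simp [Matrix.mul_add, Matrix.mul_sub, hAQ]
    rw [hVH, hfix, Matrix.mul_smul, hVA, smul_smul, mul_comm, hexp, one_smul, hAV]
end
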